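/- arXiv:1403.3631 — 2 statements merged into one kernel-verified Lean document; each statement's English description precedes it below -/
import Mathlib

section
/- Let F be a field of characteristic zero, let π be a group, and let A = F[π] be its group algebra (MonoidAlgebra F π). If u and v are n×n matrices with entries in A such that v * u is the identity matrix, then u * v is also the identity matrix. -/
open Filter Topology
open scoped InnerProductSpace

/-- An idempotent of trace zero vanishes, for a faithful trace `a ↦ ⟪ι 1, ι a⟫` on an algebra whose
right multiplications have bounded adjoints. -/
theorem eq_zero_of_isIdempotentElem_of_inner_eq_zero {A H : Type*} [Ring A] [Algebra ℂ A]
    [NormedAddCommGroup H] [InnerProductSpace ℂ H] [CompleteSpace H] (ι : A →ₗ[ℂ] H)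
    (hι : Function.Injective ι)
    (htr : ∀ a b, ⟪ι 1, ι (a * b)⟫_ℂ = ⟪ι 1, ι (b * a)⟫_ℂ)
    (hadj : ∀ a, ∃ a' : A, ∃ C : ℝ, 0 ≤ C ∧
      (∀ x y, ⟪ι (x * a), ι y⟫_ℂ = ⟪ι x, ι (y * a')⟫_ℂ) ∧ ∀ x, ‖ι (x * a')‖ ≤ C * ‖ι x‖)
    {e : A} (he : IsIdempotentElem e) (h0 : ⟪ι 1, ι e⟫_ℂ = 0) : e = 0 := by
  set I : Submodule ℂ H := ((LinearMap.mulLeft ℂ e).range).map ι with hI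
  have mem_I (a : A) : ι (e * a) ∈ I := ⟨e * a, ⟨a, rfl⟩, rfl⟩
  set K := I.topologicalClosure with hK
  have mem_K (a : A) : ι (e * a) ∈ K := I.le_topologicalClosure (mem_I a)
  have : CompleteSpace K := I.isClosed_topologicalClosure.completeSpace_coe
  set ξ : H := K.starProjection (ι 1) with hξ
  have hξK : ξ ∈ K := Submodule.starProjection_apply_mem _ _
  have orth (w : H) (hw : w ∈ K) : ⟪ι 1 - ξ, w⟫_ℂ = 0 :=
    Submodule.starProjection_inner_eq_zero _ w hw
  obtain ⟨e', C, hC0, hadj, hC⟩ := hadj e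
  obtain ⟨s, hsI, hs⟩ := mem_closure_iff_seq_limit.1 (show ξ ∈ closure (I : Set H) from hξK)
  have (k : ℕ) : ∃ c, ι (e * c) = s k := by
    obtain ⟨_, ⟨c, rfl⟩, hc⟩ := hsI k
    exact ⟨c, hc⟩
  choose c hc using this
  have bound (k : ℕ) : ‖ι (e * c k * e - e)‖ ≤ ‖s k - ξ‖ * C := by
    set g := e * c k * e - e with hg
    have hg' : g = (e * c k - 1) * e := by rw [hg]; noncomm_ring
    have hge : g * e' = e * (c k * e * e' - e') := by rw [hg]; noncomm_ring
    have h1 : ⟪ι g, ι g⟫_ℂ = ⟪s k - ξ, ι (g * e')⟫_ℂ := by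
      conv_lhs => arg 2; rw [hg']
      rw [hadj, map_sub, hc, ← sub_sub_sub_cancel_right _ _ ξ, inner_sub_left,
        orth _ (hge ▸ mem_K _), sub_zero]
    have h2 : ‖ι g‖ * ‖ι g‖ ≤ (‖s k - ξ‖ * C) * ‖ι g‖ := by
      calc ‖ι g‖ * ‖ι g‖ = ‖⟪ι g, ι g⟫_ℂ‖ := by
            rw [inner_self_eq_norm_sq_to_K]; simp [sq]
        _ ≤ ‖s k - ξ‖ * ‖ι (g * e')‖ := h1 ▸ norm_inner_le_norm _ _
        _ ≤ ‖s k - ξ‖ * (C * ‖ι g‖) := by gcongr; exact hC g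
        _ = _ := by ring
    rcases (norm_nonneg (ι g)).eq_or_lt with h | h
    · rw [← h]
      positivity
    · exact le_of_mul_le_mul_right h2 h
  have hg : Tendsto (fun k ↦ ι (e * c k * e - e)) atTop (𝓝 0) := by
    refine squeeze_zero_norm bound ?_
    simpa using (tendsto_iff_norm_sub_tendsto_zero.1 hs).mul_const C
  have h1 (k : ℕ) : ⟪ι 1, ι (e * c k * e - e)⟫_ℂ = ⟪ι 1, s k⟫_ℂ := by
    rw [map_sub, inner_sub_right, h0, sub_zero, htr, ← mul_assoc, he.eq, hc]
  have h2 : ⟪ι 1, ξ⟫_ℂ = 0 := by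
    refine tendsto_nhds_unique ((tendsto_const_nhds (x := ι 1)).inner hs) ?_
    simpa only [h1, inner_zero_right] using (tendsto_const_nhds (x := ι 1)).inner (𝕜 := ℂ) hg
  have h3 : ξ = 0 := by
    have := orth ξ hξK
    rw [inner_sub_left, h2, zero_sub, neg_eq_zero] at this
    exact inner_self_eq_zero.1 this
  apply hι
  rw [map_zero, ← inner_self_eq_zero (𝕜 := ℂ)]
  have := orth _ (mem_K e')
  rwa [h3, sub_zero, ← hadj, one_mul] at this

/-- A countable field of characteristic zero embeds into the complex numbers. -/
theorem nonempty_ringHom_complex_of_countable (K : Type*) [Field K] [CharZero K] [Countable K] :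
    Nonempty (K →+* ℂ) := by
  obtain ⟨s, hs⟩ := exists_isTranscendenceBasis ℚ K
  obtain ⟨t, ht⟩ := exists_isTranscendenceBasis ℚ ℂ
  have hcard : Cardinal.mk ℂ = Cardinal.mk t :=
    IsAlgClosed.cardinal_eq_cardinal_transcendence_basis_of_aleph0_lt' _ ht (by simp)
      (by simpa using Cardinal.aleph0_lt_continuum)
  have : Infinite t := Cardinal.infinite_iff.2 (hcard ▸ by simpa using Cardinal.aleph0_le_continuum)
  obtain ⟨f, hf⟩ := exists_injective_nat s
  let y : s → ℂ := fun i ↦ (Infinite.natEmbedding t (f i) : ℂ)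
  have hy : AlgebraicIndependent ℚ y :=
    ht.1.comp _ ((Infinite.natEmbedding t).injective.comp hf)
  let φ : Algebra.adjoin ℚ (Set.range ((↑) : s → K)) →+* ℂ :=
    (MvPolynomial.aeval y : _ →ₐ[ℚ] ℂ).toRingHom.comp hs.1.aevalEquiv.symm.toRingEquiv.toRingHom
  have hφ : Function.Injective φ :=
    (algebraicIndependent_iff_injective_aeval.1 hy).comp hs.1.aevalEquiv.symm.injective
  let _ := φ.toAlgebra
  have := hs.isAlgebraic
  have : FaithfulSMul (Algebra.adjoin ℚ (Set.range ((↑) : s → K))) ℂ :=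
    (faithfulSMul_iff_algebraMap_injective _ _).2 hφ
  exact ⟨(IsAlgClosed.lift (R := Algebra.adjoin ℚ (Set.range ((↑) : s → K)))
    (S := K) (M := ℂ)).toRingHom⟩

section

variable {n π : Type*} [Fintype n]

/-- The coefficients of a matrix over a complex group algebra, as a square-summable family. -/
noncomputable def groupAlgebraMatrixToLp :
    Matrix n n (MonoidAlgebra ℂ π) →ₗ[ℂ] lp (fun _ : n × n × π ↦ ℂ) 2 where
  toFun x := ⟨fun p ↦ (x p.1 p.2.1).coeff p.2.2, by
    refine memℓp_gen (summable_of_hasFiniteSupport ?_)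
    refine ((Set.finite_univ (α := n)).prod ((Set.finite_univ (α := n)).prod
      (Set.finite_iUnion fun i ↦ Set.finite_iUnion fun j ↦
        (x i j).coeff.hasFiniteSupport))).subset ?_
    rintro ⟨i, j, h⟩ hp
    simp only [Set.mem_prod, Set.mem_univ, true_and, Set.mem_iUnion]
    refine ⟨i, j, fun h0 ↦ hp ?_⟩
    simp [h0]⟩
  map_add' x y := by ext; simp; rfl
  map_smul' c x := by ext; simp

@[simp]
theorem groupAlgebraMatrixToLp_apply (x : Matrix n n (MonoidAlgebra ℂ π)) (p : n × n × π) :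
    groupAlgebraMatrixToLp x p = (x p.1 p.2.1).coeff p.2.2 := rfl

theorem groupAlgebraMatrixToLp_injective :
    Function.Injective (groupAlgebraMatrixToLp (n := n) (π := π)) := by
  intro x y h
  ext i j g
  exact congrArg (fun f : lp (fun _ : n × n × π ↦ ℂ) 2 ↦ f (i, j, g)) h

variable [DecidableEq n]

theorem groupAlgebraMatrixToLp_single [DecidableEq π] (i j : n) (g : π) (c : ℂ) :
    groupAlgebraMatrixToLp (Matrix.single i j (MonoidAlgebra.single g c)) =
      lp.single 2 (i, j, g) c := by
  ext ⟨k, l, h⟩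
  rw [groupAlgebraMatrixToLp_apply, lp.single_apply, Pi.single_apply, Matrix.single_apply]
  simp only [Prod.mk.injEq]
  by_cases hk : i = k <;> by_cases hl : j = l <;>
    simp [hk, hl, eq_comm, MonoidAlgebra.coeff_single, Finsupp.single_apply]

theorem Matrix.monoidAlgebra_induction {R M : Type*} [Semiring R]
    {P : Matrix n n (MonoidAlgebra R M) → Prop} (x : Matrix n n (MonoidAlgebra R M)) (zero : P 0)
    (add : ∀ x y, P x → P y → P (x + y))
    (single : ∀ i j g c, P (Matrix.single i j (MonoidAlgebra.single g c))) : P x := by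
  refine x.induction_on' zero add fun i j a ↦ ?_
  refine a.induction_linear (by simpa using zero) (fun a b ha hb ↦ ?_) (single i j)
  rw [Matrix.single_add]
  exact add _ _ ha hb

theorem MonoidAlgebra.coeff_mul_one_comm {R : Type*} [CommSemiring R] [Group π]
    (x y : MonoidAlgebra R π) :
    (x * y).coeff 1 = (y * x).coeff 1 := by
  induction x using MonoidAlgebra.induction_linear with
  | zero => simp
  | add x x' h h' => simp [add_mul, mul_add, h, h']
  | single g c =>
    induction y using MonoidAlgebra.induction_linear with
    | zero => simp
    | add x x' h h' =>
      simp only [add_mul, mul_add, MonoidAlgebra.coeff_add, Finsupp.add_apply, h, h']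
    | single h d =>
      classical
      simp [MonoidAlgebra.single_mul_single, MonoidAlgebra.coeff_single, Finsupp.single_apply,
        mul_comm c, mul_eq_one_comm (a := g)]

variable [Group π]

local notation "ι" => groupAlgebraMatrixToLp

theorem inner_groupAlgebraMatrixToLp_one (a : Matrix n n (MonoidAlgebra ℂ π)) :
    ⟪ι 1, ι a⟫_ℂ = a.trace.coeff 1 := by
  classical
  have h1 : (1 : Matrix n n (MonoidAlgebra ℂ π)) =
      ∑ i, Matrix.single i i (MonoidAlgebra.single 1 1) := by
    rw [← MonoidAlgebra.one_def, ← Matrix.diagonal_one, Matrix.sum_single_eq_diagonal]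
  rw [h1, map_sum, sum_inner]
  simp [groupAlgebraMatrixToLp_single, lp.inner_single_left, Matrix.trace, MonoidAlgebra.coeff_sum]

theorem inner_groupAlgebraMatrixToLp_one_mul_comm (a b : Matrix n n (MonoidAlgebra ℂ π)) :
    ⟪ι 1, ι (a * b)⟫_ℂ = ⟪ι 1, ι (b * a)⟫_ℂ := by
  simp only [inner_groupAlgebraMatrixToLp_one, Matrix.trace, Matrix.diag, Matrix.mul_apply,
    MonoidAlgebra.coeff_sum, Finsupp.finsetSum_apply]
  rw [Finset.sum_comm]
  simp only [MonoidAlgebra.coeff_mul_one_comm]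

theorem inner_groupAlgebraMatrixToLp_mul_single (i j : n) (g : π) (c : ℂ)
    (x y : Matrix n n (MonoidAlgebra ℂ π)) :
    ⟪ι (x * Matrix.single i j (MonoidAlgebra.single g c)), ι y⟫_ℂ =
      ⟪ι x, ι (y * Matrix.single j i (MonoidAlgebra.single g⁻¹ (star c)))⟫_ℂ := by
  classical
  induction x using Matrix.monoidAlgebra_induction with
  | zero => simp
  | add x x' h h' => simp only [add_mul, map_add, inner_add_left, h, h']
  | single k l h d =>
    rw [groupAlgebraMatrixToLp_single, lp.inner_single_left, groupAlgebraMatrixToLp_apply]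
    by_cases hl : l = i
    · subst hl
      rw [Matrix.single_mul_single_same, MonoidAlgebra.single_mul_single,
        groupAlgebraMatrixToLp_single, lp.inner_single_left]
      simp [MonoidAlgebra.coeff_mul_single_apply]
      ring
    · rw [Matrix.single_mul_single_of_ne _ _ _ _ hl,
        Matrix.mul_single_apply_of_ne _ _ _ _ _ hl]
      simp

theorem norm_groupAlgebraMatrixToLp_mul_single_one_le (i : n)
    (x : Matrix n n (MonoidAlgebra ℂ π)) :
    ‖ι (x * Matrix.single i i 1)‖ ≤ ‖ι x‖ := by
  have h := inner_groupAlgebraMatrixToLp_mul_single i i 1 1 x (x * Matrix.single i i 1)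
  rw [star_one, inv_one, ← MonoidAlgebra.one_def, mul_assoc, Matrix.single_mul_single_same,
    one_mul] at h
  have h2 : ‖ι (x * Matrix.single i i 1)‖ * ‖ι (x * Matrix.single i i 1)‖ ≤
      ‖ι x‖ * ‖ι (x * Matrix.single i i 1)‖ := by
    calc _ = ‖⟪ι (x * Matrix.single i i 1), ι (x * Matrix.single i i 1)⟫_ℂ‖ := by
            rw [inner_self_eq_norm_sq_to_K]; simp [sq]
      _ ≤ _ := h ▸ norm_inner_le_norm _ _
  nlinarith [norm_nonneg (ι x), norm_nonneg (ι (x * Matrix.single i i 1))]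

theorem norm_groupAlgebraMatrixToLp_mul_single_le (i j : n) (g : π) (c : ℂ)
    (x : Matrix n n (MonoidAlgebra ℂ π)) :
    ‖ι (x * Matrix.single i j (MonoidAlgebra.single g c))‖ ≤ ‖c‖ * ‖ι x‖ := by
  have h := inner_groupAlgebraMatrixToLp_mul_single i j g c x
    (x * Matrix.single i j (MonoidAlgebra.single g c))
  have h1 : Matrix.single i i (MonoidAlgebra.single (1 : π) (c * star c)) =
      (c * star c) • Matrix.single i i (1 : MonoidAlgebra ℂ π) := by
    simp [MonoidAlgebra.one_def]
  rw [mul_assoc, Matrix.single_mul_single_same, MonoidAlgebra.single_mul_single, mul_inv_cancel,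
    h1, Matrix.mul_smul, map_smul, inner_smul_right, inner_self_eq_norm_sq_to_K] at h
  have h2 := congrArg norm h
  simp only [norm_pow, RCLike.norm_ofReal, abs_norm, norm_mul, norm_star] at h2
  have h3 := (norm_inner_le_norm (𝕜 := ℂ) (ι x) (ι (x * Matrix.single i i 1))).trans
    (mul_le_mul_of_nonneg_left (norm_groupAlgebraMatrixToLp_mul_single_one_le i x) (norm_nonneg _))
  refine le_of_sq_le_sq ?_ (by positivity)
  calc _ = ‖c‖ * ‖c‖ * _ := h2
    _ ≤ ‖c‖ * ‖c‖ * (‖ι x‖ * ‖ι x‖) := by gcongr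
    _ = _ := by ring

theorem exists_adjoint_mul_right (a : Matrix n n (MonoidAlgebra ℂ π)) :
    ∃ a' : Matrix n n (MonoidAlgebra ℂ π), ∃ C : ℝ, 0 ≤ C ∧
      (∀ x y, ⟪ι (x * a), ι y⟫_ℂ = ⟪ι x, ι (y * a')⟫_ℂ) ∧ ∀ x, ‖ι (x * a')‖ ≤ C * ‖ι x‖ := by
  induction a using Matrix.monoidAlgebra_induction with
  | zero => exact ⟨0, 0, le_rfl, by simp, by simp⟩
  | add a b ha hb =>
    obtain ⟨a', C, hC, ha, ha'⟩ := ha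
    obtain ⟨b', D, hD, hb, hb'⟩ := hb
    refine ⟨a' + b', C + D, add_nonneg hC hD, fun x y ↦ ?_, fun x ↦ ?_⟩
    · simp only [mul_add, map_add, inner_add_left, inner_add_right, ha, hb]
    · rw [mul_add, map_add, add_mul]
      exact norm_add_le_of_le (ha' x) (hb' x)
  | single i j g c =>
    exact ⟨_, _, norm_nonneg _, inner_groupAlgebraMatrixToLp_mul_single i j g c,
      norm_groupAlgebraMatrixToLp_mul_single_le _ _ _ _⟩

theorem mul_eq_one_of_mul_eq_one_of_complex {u v : Matrix n n (MonoidAlgebra ℂ π)}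
    (h : v * u = 1) : u * v = 1 := by
  have huv : IsIdempotentElem (u * v) := by
    rw [IsIdempotentElem, mul_assoc, ← mul_assoc v, h, one_mul]
  refine (sub_eq_zero.1 <| eq_zero_of_isIdempotentElem_of_inner_eq_zero ι
    groupAlgebraMatrixToLp_injective inner_groupAlgebraMatrixToLp_one_mul_comm
    exists_adjoint_mul_right huv.one_sub ?_).symm
  rw [map_sub, inner_sub_right, inner_groupAlgebraMatrixToLp_one_mul_comm, h, sub_self]

end

theorem mapMatrix_mapRingHom_injective {R S M n : Type*} [Semiring R] [Semiring S] [Monoid M]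
    [Fintype n] [DecidableEq n] {f : R →+* S} (hf : Function.Injective f) :
    Function.Injective (MonoidAlgebra.mapRingHom M f).mapMatrix (α := Matrix n n _) :=
  Matrix.map_injective (MonoidAlgebra.map_injective _ hf)

theorem MonoidAlgebra.mem_range_mapRingHom {R S M : Type*} [Semiring R] [Semiring S] [Monoid M]
    {f : R →+* S} {x : MonoidAlgebra S M} (hx : ∀ m, x.coeff m ∈ Set.range f) :
    ∃ y, MonoidAlgebra.mapRingHom M f y = x := by
  choose s hs using fun r : Set.range f ↦ r.2
  classical
  refine ⟨∑ m ∈ x.coeff.support, MonoidAlgebra.single m (s ⟨_, hx m⟩), ?_⟩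
  rw [map_sum]
  ext m
  simp [MonoidAlgebra.coeff_sum, Finsupp.finsetSum_apply, MonoidAlgebra.coeff_single, hs,
    Finsupp.single_apply]
  grind

/-- Kaplansky's lemma: over the group algebra `F[π]` of a group `π` over a field `F` of
characteristic zero, one-sided inverses of square matrices are two-sided. -/
theorem kaplansky_matrix_one_sided_inverse
    (F : Type*) [Field F] [CharZero F] (π : Type*) [Group π] (n : ℕ)
    (u v : Matrix (Fin n) (Fin n) (MonoidAlgebra F π))
    (h : v * u = 1) : u * v = 1 := by
  let S (x : Matrix (Fin n) (Fin n) (MonoidAlgebra F π)) : Set F :=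
    ⋃ i, ⋃ j, (x i j).coeff '' (x i j).coeff.support
  have hS x : (S x).Countable := Set.countable_iUnion fun i ↦ Set.countable_iUnion fun j ↦
    ((x i j).coeff.support.countable_toSet.image _)
  let K := IntermediateField.adjoin ℚ (S u ∪ S v)
  have : Countable K := by
    have := ((hS u).union (hS v)).to_subtype
    rw [← Cardinal.mk_le_aleph0_iff, ← Cardinal.lift_le_aleph0]
    exact (IntermediateField.lift_cardinalMk_adjoin_le ℚ _).trans (by simp)
  obtain ⟨φ⟩ := nonempty_ringHom_complex_of_countable K
  have lift (x : Matrix (Fin n) (Fin n) (MonoidAlgebra F π)) (hx : S x ⊆ S u ∪ S v) :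
      ∃ y, (MonoidAlgebra.mapRingHom π (algebraMap K F)).mapMatrix y = x := by
    have (i j : Fin n) : ∃ y, MonoidAlgebra.mapRingHom π (algebraMap K F) y = x i j := by
      refine MonoidAlgebra.mem_range_mapRingHom fun m ↦ ?_
      by_cases hm : (x i j).coeff m = 0
      · exact ⟨0, by rw [hm, map_zero]⟩
      · have : (x i j).coeff m ∈ S x :=
          Set.mem_iUnion₂.2 ⟨i, j, m, by simpa using hm, rfl⟩
        exact ⟨⟨_, IntermediateField.subset_adjoin ℚ _ (hx this)⟩, rfl⟩
    choose y hy using this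
    exact ⟨Matrix.of y, by ext1; exact hy _ _⟩
  obtain ⟨u', hu⟩ := lift u Set.subset_union_left
  obtain ⟨v', hv⟩ := lift v Set.subset_union_right
  rw [← hu, ← hv, ← map_mul] at h
  replace h : v' * u' = 1 :=
    mapMatrix_mapRingHom_injective (algebraMap K F).injective (h.trans (map_one _).symm)
  have h' : u' * v' = 1 := by
    apply mapMatrix_mapRingHom_injective φ.injective
    rw [map_mul, map_one]
    apply mul_eq_one_of_mul_eq_one_of_complex
    rw [← map_mul, h, map_one]
  rw [← hu, ← hv, ← map_mul, h', map_one]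
end

section
/- Let π be a group and let Λ = ℤ[π] be its integral group ring (MonoidAlgebra ℤ π). If u and v are n×n matrices with entries in Λ such that v * u is the identity matrix, then u * v is also the identity matrix. -/
/-- A faithful positive trace on a real `*`-algebra for which left multiplications are bounded. -/
structure IsBoundedFaithfulTrace {A : Type*} [Ring A] [StarRing A] [Algebra ℝ A]
    (τ : A →ₗ[ℝ] ℝ) : Prop where
  mul_comm : ∀ x y, τ (x * y) = τ (y * x)
  nonneg : ∀ x, 0 ≤ τ (star x * x)
  eq_zero : ∀ x, τ (star x * x) = 0 → x = 0
  bounded : ∀ a, ∃ K : ℝ, ∀ x, τ (star (a * x) * (a * x)) ≤ K * τ (star x * x)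

section Trace

variable {A : Type*} [Ring A] [StarRing A] [Algebra ℝ A] {τ : A →ₗ[ℝ] ℝ}

theorem trace_star_add_mul_add_le (hτ : ∀ x, 0 ≤ τ (star x * x)) (x y : A) :
    τ (star (x + y) * (x + y)) ≤ 2 * τ (star x * x) + 2 * τ (star y * y) := by
  have h := hτ (x - y)
  simp only [star_sub, star_add, sub_mul, mul_sub, add_mul, mul_add, map_sub, map_add] at h ⊢
  linarith

theorem bounded_mul_left_add (hτ : ∀ x, 0 ≤ τ (star x * x)) {a b : A}
    (ha : ∃ K : ℝ, ∀ x, τ (star (a * x) * (a * x)) ≤ K * τ (star x * x))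
    (hb : ∃ K : ℝ, ∀ x, τ (star (b * x) * (b * x)) ≤ K * τ (star x * x)) :
    ∃ K : ℝ, ∀ x, τ (star ((a + b) * x) * ((a + b) * x)) ≤ K * τ (star x * x) := by
  obtain ⟨K, hK⟩ := ha
  obtain ⟨L, hL⟩ := hb
  refine ⟨2 * K + 2 * L, fun x => ?_⟩
  have h := trace_star_add_mul_add_le hτ (a * x) (b * x)
  rw [add_mul a b x]
  linarith [hK x, hL x]

namespace IsBoundedFaithfulTrace

theorem exists_pos_bound (hτ : IsBoundedFaithfulTrace τ) (a : A) :
    ∃ K : ℝ, 0 < K ∧ ∀ x, τ (star (a * x) * (a * x)) ≤ K * τ (star x * x) := by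
  obtain ⟨K, hK⟩ := hτ.bounded a
  refine ⟨max K 1, by positivity, fun x => (hK x).trans ?_⟩
  exact mul_le_mul_of_nonneg_right (le_max_left _ _) (hτ.nonneg x)

/-- If `a` is left invertible then `1 - ε a⋆a` is a strict contraction for small `ε`. -/
theorem exists_contraction [StarModule ℝ A] (hτ : IsBoundedFaithfulTrace τ) {a b : A}
    (h : b * a = 1) :
    ∃ ε r : ℝ, 0 ≤ r ∧ r < 1 ∧ ∀ x, τ (star ((1 - ε • (star a * a)) * x) *
      ((1 - ε • (star a * a)) * x)) ≤ r * τ (star x * x) := by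
  obtain ⟨K, hK0, hK⟩ := hτ.exists_pos_bound (star a)
  obtain ⟨L, hL0, hL⟩ := hτ.exists_pos_bound b
  have key : ∀ x, τ (star ((1 - K⁻¹ • (star a * a)) * x) * ((1 - K⁻¹ • (star a * a)) * x)) ≤
      (1 - K⁻¹ * L⁻¹) * τ (star x * x) := by
    intro x
    have hx := hL (a * x)
    rw [← mul_assoc b a x, h, one_mul] at hx
    have hx' : L⁻¹ * τ (star x * x) ≤ τ (star (a * x) * (a * x)) := by
      rw [inv_mul_le_iff₀ hL0]; exact hx
    have hy : K⁻¹ * τ (star (star a * (a * x)) * (star a * (a * x))) ≤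
        τ (star (a * x) * (a * x)) := by
      rw [inv_mul_le_iff₀ hK0]; exact hK (a * x)
    have e : star ((1 - K⁻¹ • (star a * a)) * x) * ((1 - K⁻¹ • (star a * a)) * x) =
        star x * x - (2 * K⁻¹) • (star (a * x) * (a * x)) +
          (K⁻¹ * K⁻¹) • (star (star a * (a * x)) * (star a * (a * x))) := by
      simp only [star_mul, star_sub, star_smul, star_star, star_trivial, sub_mul, mul_sub, one_mul,
        smul_mul_assoc, mul_smul_comm, smul_sub, mul_assoc, two_mul, add_smul, mul_smul]
      abel
    have hK1 : 0 < K⁻¹ := inv_pos.2 hK0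
    rw [e, map_add, map_sub, map_smul, map_smul, smul_eq_mul, smul_eq_mul]
    nlinarith [mul_le_mul_of_nonneg_left hy hK1.le, mul_le_mul_of_nonneg_left hx' hK1.le]
  have hKL : 0 < K⁻¹ * L⁻¹ := by positivity
  refine ⟨K⁻¹, max (1 - K⁻¹ * L⁻¹) 0, le_max_right _ _, max_lt (by linarith) one_pos, fun x => ?_⟩
  exact (key x).trans (mul_le_mul_of_nonneg_right (le_max_left _ _) (hτ.nonneg x))

theorem trace_pow_one_sub_smul_comm (hτ : IsBoundedFaithfulTrace τ) (a c : A) (ε : ℝ) (k : ℕ) :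
    τ ((1 - ε • (a * c)) ^ k) = τ ((1 - ε • (c * a)) ^ k) := by
  have hcomm : SemiconjBy a (1 - ε • (c * a)) (1 - ε • (a * c)) := by
    simp [SemiconjBy, mul_sub, sub_mul, mul_assoc]
  induction k with
  | zero => simp
  | succ k ih =>
    have h1 : (1 - ε • (a * c)) ^ (k + 1) =
        (1 - ε • (a * c)) ^ k - ε • (a * ((1 - ε • (c * a)) ^ k * c)) := by
      rw [← mul_assoc, (hcomm.pow_right k).eq, pow_succ]
      simp [mul_sub, mul_assoc]
    have h2 : (1 - ε • (c * a)) ^ (k + 1) =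
        (1 - ε • (c * a)) ^ k - ε • ((1 - ε • (c * a)) ^ k * c * a) := by
      rw [pow_succ]
      simp [mul_sub, mul_assoc]
    rw [h1, h2, map_sub, map_sub, map_smul, map_smul, ih, hτ.mul_comm a]

/-- A real `*`-algebra with a bounded faithful trace is Dedekind finite. -/
theorem isDedekindFiniteMonoid [StarModule ℝ A] (hτ : IsBoundedFaithfulTrace τ) :
    IsDedekindFiniteMonoid A where
  mul_eq_one_symm {b a} h := by
    obtain ⟨ε, r, hr0, hr1, hr⟩ := hτ.exists_contraction h
    set g : A := 1 - ε • (a * star a) with hg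
    set e : A := 1 - a * b with he
    have hgs : star g = g := by simp [hg]
    have hea : e * a = 0 := by rw [he, sub_mul, mul_assoc, h]; simp
    have heg : e * g = e := by
      rw [hg, mul_sub, mul_smul_comm, ← mul_assoc, hea]; simp
    have hegm : ∀ m : ℕ, e * g ^ m = e := by
      intro m
      induction m with
      | zero => simp
      | succ m ih => rw [pow_succ, ← mul_assoc, ih, heg]
    set p : A := 1 - ε • (star a * a) with hp
    have hps : star p = p := by simp [hp]
    have hp_pow : ∀ m : ℕ, τ (star (p ^ m) * p ^ m) ≤ r ^ m * τ 1 := by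
      intro m
      induction m with
      | zero => simp
      | succ m ih =>
        rw [pow_succ' p, pow_succ' r, mul_assoc r]
        exact (hr _).trans (mul_le_mul_of_nonneg_left ih hr0)
    have hg_pow : ∀ m : ℕ, τ (star (g ^ m) * g ^ m) ≤ r ^ m * τ 1 := by
      intro m
      have := hp_pow m
      rw [star_pow, hps, ← pow_add, hp, ← hτ.trace_pow_one_sub_smul_comm] at this
      rwa [star_pow, hgs, ← pow_add]
    obtain ⟨K, hK0, hK⟩ := hτ.exists_pos_bound e
    have hle : ∀ m : ℕ, τ (star e * e) ≤ K * (r ^ m * τ 1) := by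
      intro m
      have := hK (g ^ m)
      rw [hegm] at this
      exact this.trans (mul_le_mul_of_nonneg_left (hg_pow m) hK0.le)
    have hlim : Filter.Tendsto (fun m : ℕ => K * (r ^ m * τ 1)) Filter.atTop (nhds 0) := by
      simpa using ((tendsto_pow_atTop_nhds_zero_of_lt_one hr0 hr1).mul_const (τ 1)).const_mul K
    have he0 : e = 0 := hτ.eq_zero e
      (le_antisymm (ge_of_tendsto' hlim hle) (hτ.nonneg e))
    exact (sub_eq_zero.1 he0).symm

/-- The composite of a bounded faithful trace with the matrix trace is a bounded faithful trace. -/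
theorem matrix {n : Type*} [Fintype n] [DecidableEq n] (hτ : IsBoundedFaithfulTrace τ) :
    IsBoundedFaithfulTrace (τ ∘ₗ Matrix.traceLinearMap n ℝ A) := by
  have hsq : ∀ x : Matrix n n A, (τ ∘ₗ Matrix.traceLinearMap n ℝ A) (star x * x) =
      ∑ i, ∑ j, τ (star (x j i) * x j i) := by
    intro x
    simp [Matrix.trace, Matrix.mul_apply, Matrix.star_apply]
  have hnonneg : ∀ x : Matrix n n A,
      0 ≤ (τ ∘ₗ Matrix.traceLinearMap n ℝ A) (star x * x) := fun x => by
    rw [hsq]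
    exact Finset.sum_nonneg fun i _ => Finset.sum_nonneg fun j _ => hτ.nonneg _
  refine ⟨fun x y => ?_, hnonneg, fun x hx => ?_, fun a => ?_⟩
  · simp only [LinearMap.comp_apply, Matrix.traceLinearMap_apply, Matrix.trace, Matrix.diag_apply,
      Matrix.mul_apply, map_sum]
    rw [Finset.sum_comm]
    simp_rw [hτ.mul_comm (x _ _)]
  · rw [hsq, Finset.sum_eq_zero_iff_of_nonneg
      fun i _ => Finset.sum_nonneg fun j _ => hτ.nonneg _] at hx
    ext j i
    have hi := hx i (Finset.mem_univ i)
    rw [Finset.sum_eq_zero_iff_of_nonneg fun j _ => hτ.nonneg _] at hi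
    exact hτ.eq_zero _ (hi j (Finset.mem_univ j))
  · induction a using Matrix.induction_on' with
    | h_zero => exact ⟨0, fun x => by simp⟩
    | h_add p q hp hq => exact bounded_mul_left_add hnonneg hp hq
    | h_std_basis i j c =>
      obtain ⟨K, hK0, hK⟩ := hτ.exists_pos_bound c
      refine ⟨K, fun x => ?_⟩
      rw [hsq, hsq, Finset.mul_sum]
      refine Finset.sum_le_sum fun l _ => ?_
      rw [Finset.sum_eq_single i (fun k _ hk => by
        simp [Matrix.single_mul_apply_of_ne _ _ _ _ _ hk]) (by simp),
        Matrix.single_mul_apply_same]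
      refine (hK _).trans (mul_le_mul_of_nonneg_left ?_ hK0.le)
      exact Finset.single_le_sum (f := fun k => τ (star (x k l) * x k l))
        (fun k _ => hτ.nonneg _) (Finset.mem_univ j)

end IsBoundedFaithfulTrace

end Trace

namespace MonoidAlgebra

variable {G : Type*} [Group G]

/-- The involution of the real group algebra that inverts group elements. -/
noncomputable instance instStarRingRealGroup : StarRing (MonoidAlgebra ℝ G) where
  star x := mapDomain (·⁻¹) x
  star_involutive x := by
    induction x using induction_linear with
    | zero => simp
    | add x y hx hy => simp only [mapDomain_add, hx, hy]
    | single g r => simp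
  star_mul x y := by
    induction x using induction_linear with
    | zero => simp
    | add x x' hx hx' => simp only [mapDomain_add, add_mul, mul_add, hx, hx']
    | single g r =>
      induction y using induction_linear with
      | zero => simp
      | add y y' hy hy' => simp only [mapDomain_add, add_mul, mul_add, hy, hy']
      | single g' r' => simp [single_mul_single, mul_comm]
  star_add x y := mapDomain_add _ x y

theorem star_single_real (g : G) (r : ℝ) : star (single g r) = single g⁻¹ r :=
  mapDomain_single

theorem coeff_star_real (x : MonoidAlgebra ℝ G) (g : G) : (star x).coeff g = x.coeff g⁻¹ := by
  induction x using induction_linear with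
  | zero => simp
  | add x y hx hy => simp [hx, hy]
  | single h r =>
    classical
    simp [star_single_real, Finsupp.single_apply, inv_eq_iff_eq_inv]

instance instStarModuleRealGroup : StarModule ℝ (MonoidAlgebra ℝ G) where
  star_smul r x := by
    ext g
    simp [coeff_star_real]

/-- The canonical trace on the real group algebra, the coefficient of the identity. -/
noncomputable def coeffOneLinearMap (G : Type*) [Group G] : MonoidAlgebra ℝ G →ₗ[ℝ] ℝ where
  toFun x := x.coeff 1
  map_add' _ _ := rfl
  map_smul' _ _ := rfl

theorem coeffOneLinearMap_star_mul_self (x : MonoidAlgebra ℝ G) :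
    coeffOneLinearMap G (star x * x) = ∑ g ∈ x.coeff.support, x.coeff g * x.coeff g := by
  change (star x * x).coeff 1 = _
  rw [coeff_mul_apply_right]
  simp [Finsupp.sum, coeff_star_real]

theorem isBoundedFaithfulTrace_coeffOneLinearMap :
    IsBoundedFaithfulTrace (coeffOneLinearMap G) := by
  have hnonneg : ∀ x : MonoidAlgebra ℝ G, 0 ≤ coeffOneLinearMap G (star x * x) := fun x => by
    rw [coeffOneLinearMap_star_mul_self]
    exact Finset.sum_nonneg fun g _ => mul_self_nonneg _
  refine ⟨fun x y => ?_, hnonneg, fun x hx => ?_, fun a => ?_⟩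
  · induction x using induction_linear with
    | zero => simp
    | add x x' hx hx' => simp only [add_mul, mul_add, map_add, hx, hx']
    | single g r =>
      change (single g r * y).coeff 1 = (y * single g r).coeff 1
      simp [coeff_single_mul_apply, coeff_mul_single_apply, mul_comm]
  · rw [coeffOneLinearMap_star_mul_self,
      Finset.sum_eq_zero_iff_of_nonneg fun g _ => mul_self_nonneg _] at hx
    ext g
    by_contra hg
    exact hg (mul_self_eq_zero.1 (hx g (Finsupp.mem_support_iff.2 hg)))
  · induction a using induction_linear with
    | zero => exact ⟨0, fun x => by simp⟩
    | add a b ha hb => exact bounded_mul_left_add hnonneg ha hb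
    | single g r =>
      refine ⟨r * r, fun x => le_of_eq ?_⟩
      have h : star (single g r * x) * (single g r * x) = (r * r) • (star x * x) := by
        rw [star_mul, mul_assoc, ← mul_assoc (star (single g r)), star_single_real,
          single_mul_single, inv_mul_cancel,
          show single (1 : G) (r * r) = (r * r) • 1 by simp [one_def], smul_mul_assoc, one_mul,
          mul_smul_comm]
      rw [h, map_smul, smul_eq_mul]

end MonoidAlgebra


/-- Integral version of Kaplansky's lemma: over the integral group ring `ℤ[π]` of a group `π`,
one-sided inverses of square matrices are two-sided. -/
theorem kaplansky_matrix_one_sided_inverse_int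
    (π : Type*) [Group π] (n : ℕ)
    (u v : Matrix (Fin n) (Fin n) (MonoidAlgebra ℤ π))
    (h : v * u = 1) : u * v = 1 := by
  let φ := (MonoidAlgebra.mapRingHom π (Int.castRingHom ℝ)).mapMatrix (m := Fin n)
  have hφ : Function.Injective φ :=
    Matrix.map_injective (MonoidAlgebra.map_injective _ Int.cast_injective)
  have := (MonoidAlgebra.isBoundedFaithfulTrace_coeffOneLinearMap (G := π)).matrix
    (n := Fin n) |>.isDedekindFiniteMonoid
  apply hφ
  rw [map_mul, map_one]
  exact mul_eq_one_symm (by rw [← map_mul, h, map_one])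
end
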